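/- Let F be a finite field, let k ≥ 2, let V' be a (2k−2)-dimensional F-vector space and let V be a 2k-dimensional F-vector space. Suppose that for every pair of distinct bisections {W1, W2} and {W1', W2'} of V' into (k−1)-dimensional subspaces there exists a (k−1)-dimensional subspace of V' intersecting each of W1, W2, W1', W2' trivially. Then for every pair of distinct bisections {V1, V2} and {V1', V2'} of V into k-dimensional subspaces there exists a k-dimensional subspace of V intersecting each of V1, V2, V1', V2' trivially. -/

import Mathlib

open Module

/-- `{V₁, V₂}` is a bisection of `V` into two `k`-dimensional subspaces. -/
def IsBisection {F V : Type*} [Field F] [AddCommGroup V] [Module F V]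
    (k : ℕ) (V₁ V₂ : Submodule F V) : Prop :=
  finrank F V₁ = k ∧ finrank F V₂ = k ∧ V₁ ⊓ V₂ = ⊥ ∧ V₁ ⊔ V₂ = ⊤

/-- Concurrent completeness of the geometry `Proj^{m,k}_{(0,0)}(W)`. -/
def ConcurrentlyCompleteZero (F W : Type*) [Field F] [AddCommGroup W] [Module F W]
    (m k : ℕ) : Prop :=
  ∀ W₁ W₂ W₁' W₂' : Submodule F W, IsBisection k W₁ W₂ → IsBisection k W₁' W₂' →
    ({W₁, W₂} : Set (Submodule F W)) ≠ {W₁', W₂'} →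
    ∃ U : Submodule F W, finrank F U = m ∧
      U ⊓ W₁ = ⊥ ∧ U ⊓ W₂ = ⊥ ∧ U ⊓ W₁' = ⊥ ∧ U ⊓ W₂' = ⊥

section

variable {F V W : Type*} [Field F] [AddCommGroup V] [Module F V] [AddCommGroup W] [Module F W]

theorem finrank_map_add_finrank_inf_ker [FiniteDimensional F V] (φ : V →ₗ[F] W)
    (p : Submodule F V) :
    finrank F (p.map φ) + finrank F (p ⊓ LinearMap.ker φ : Submodule F V) = finrank F p := by
  rw [← LinearMap.finrank_range_add_finrank_ker (φ.domRestrict p), LinearMap.range_domRestrict,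
    LinearMap.ker_domRestrict, ← Submodule.map_comap_subtype, Submodule.finrank_map_subtype_eq]

theorem finrank_inf_ker_add_one [FiniteDimensional F V] {f : V →ₗ[F] F} {p : Submodule F V}
    {x : V} (hx : x ∈ p) (hfx : f x ≠ 0) :
    finrank F (p ⊓ LinearMap.ker f : Submodule F V) + 1 = finrank F p := by
  rw [← finrank_map_add_finrank_inf_ker f p, add_comm]
  have hne : p.map f ≠ ⊥ := fun h ↦ hfx <| by
    simpa [h] using Submodule.mem_map_of_mem (f := f) hx
  rw [(eq_bot_or_eq_top (p.map f)).resolve_left hne, finrank_top, finrank_self]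

theorem exists_dual_ne_zero_ne_zero_le_ker {p : Submodule F V} {a b : V} (ha : a ∉ p)
    (hb : b ∉ p) : ∃ f : V →ₗ[F] F, f a ≠ 0 ∧ f b ≠ 0 ∧ p ≤ LinearMap.ker f := by
  obtain ⟨f, hfa, hf⟩ := Submodule.exists_le_ker_of_notMem ha
  obtain ⟨g, hgb, hg⟩ := Submodule.exists_le_ker_of_notMem hb
  by_cases hfb : f b = 0
  · by_cases hga : g a = 0
    · refine ⟨f + g, by simpa [hga], by simpa [hfb], fun x hx ↦ ?_⟩
      have h₁ := hf hx
      have h₂ := hg hx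
      simp_all
    · exact ⟨g, hga, hgb, hg⟩
  · exact ⟨f, hfa, hfb, hf⟩

/-- Over a finite field, four half-dimensional subspaces of a space of dimension at least four do
not cover it. -/
theorem exists_notMem_four_of_finrank_eq [Fintype F] [FiniteDimensional F V] {k : ℕ} (hk : 2 ≤ k)
    (hV : finrank F V = 2 * k) {p : Fin 4 → Submodule F V} (hp : ∀ i, finrank F (p i) = k) :
    ∃ v, ∀ i, v ∉ p i := by
  classical
  by_contra! hcov
  have : Finite V := Module.finite_of_finite F
  have : Fintype V := Fintype.ofFinite V
  have hcard (i : Fin 4) : ((p i : Set V) \ {0}).ncard + 1 = Fintype.card F ^ k := by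
    rw [Set.ncard_sdiff_singleton_add_one (p i).zero_mem (Set.toFinite _), ← hp i,
      ← Module.card_eq_pow_finrank, ← Nat.card_eq_fintype_card]
    rfl
  have huniv : (Set.univ : Set V) ⊆ {0} ∪ ⋃ i, ((p i : Set V) \ {0}) := by
    intro v _
    by_cases hv : v = 0
    · simp [hv]
    · obtain ⟨i, hi⟩ := hcov v
      exact Or.inr (Set.mem_iUnion.2 ⟨i, hi, hv⟩)
  have hle := (Set.ncard_le_ncard huniv (Set.toFinite _)).trans (Set.ncard_union_le _ _)
  have hsum : (⋃ i, ((p i : Set V) \ {0})).ncard ≤ ∑ i, ((p i : Set V) \ {0}).ncard :=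
    Set.ncard_iUnion_le_of_fintype _
  rw [Set.ncard_univ, Nat.card_eq_fintype_card, Module.card_eq_pow_finrank (K := F), hV,
    Set.ncard_singleton, mul_comm, pow_mul] at hle
  have hQ : 4 ≤ Fintype.card F ^ k :=
    calc 4 = 2 ^ 2 := rfl
      _ ≤ 2 ^ k := Nat.pow_le_pow_right (by norm_num) hk
      _ ≤ _ := Nat.pow_le_pow_left Fintype.one_lt_card k
  simp only [Fin.sum_univ_four] at hsum
  have h0 := hcard 0
  have h1 := hcard 1
  have h2 := hcard 2
  have h3 := hcard 3
  nlinarith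

/-- The two members of a bisection have a common complement. -/
theorem IsBisection.exists_common_complement [FiniteDimensional F V] {k : ℕ} {S T : Submodule F V}
    (h : IsBisection k S T) : ∃ U : Submodule F V, finrank F U = k ∧ U ⊓ S = ⊥ ∧ U ⊓ T = ⊥ := by
  obtain ⟨hS, hT, hinf, -⟩ := h
  let e : S ≃ₗ[F] T := LinearEquiv.ofFinrankEq _ _ (hS.trans hT.symm)
  have hST {x : V} (hxS : x ∈ S) (hxT : x ∈ T) : x = 0 := by
    have : x ∈ S ⊓ T := ⟨hxS, hxT⟩
    simpa [hinf] using this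
  let φ : S →ₗ[F] V := S.subtype + T.subtype ∘ₗ e.toLinearMap
  have hφ (s : S) : φ s = s + e s := rfl
  have hφS {s : S} (h : φ s ∈ S) : s = 0 := by
    have h' : (e s : V) ∈ S := by simpa [hφ] using S.sub_mem h s.2
    simpa using hST h' (e s).2
  have hφT {s : S} (h : φ s ∈ T) : s = 0 := by
    have h' : (s : V) ∈ T := by simpa [hφ] using T.sub_mem h (e s).2
    simpa using hST s.2 h'
  refine ⟨LinearMap.range φ, ?_, ?_, ?_⟩
  · rw [LinearMap.finrank_range_of_inj, hS]
    rw [← LinearMap.ker_eq_bot, LinearMap.ker_eq_bot']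
    intro s hs
    exact hφS (by rw [hs]; exact S.zero_mem)
  · rw [eq_bot_iff]
    rintro _ ⟨⟨s, rfl⟩, hs⟩
    simp [hφS hs]
  · rw [eq_bot_iff]
    rintro _ ⟨⟨s, rfl⟩, hs⟩
    simp [hφT hs]

theorem IsBisection.exists_add_eq {k : ℕ} {S T : Submodule F V} (h : IsBisection k S T) {v : V}
    (hS : v ∉ S) (hT : v ∉ T) :
    ∃ a ∈ S, ∃ b ∈ T, a + b = v ∧ a ∉ Submodule.span F {v} := by
  have hv : v ∈ S ⊔ T := by rw [h.2.2.2]; trivial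
  obtain ⟨a, ha, b, hb, hab⟩ := Submodule.mem_sup.1 hv
  refine ⟨a, ha, b, hb, hab, fun hspan ↦ ?_⟩
  obtain ⟨c, hc⟩ := Submodule.mem_span_singleton.1 hspan
  by_cases hc0 : c = 0
  · have ha0 : a = 0 := by rw [← hc, hc0, zero_smul]
    rw [ha0, zero_add] at hab
    exact hT (hab ▸ hb)
  · exact hS ((S.smul_mem_iff hc0).1 (hc ▸ ha))

/-- A bisection of `V` descends to a bisection of a quotient of a hyperplane by a line. -/
theorem IsBisection.map_comap_subtype_ker [FiniteDimensional F V] [FiniteDimensional F W] {k : ℕ}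
    (hW : finrank F W = 2 * (k - 1)) {S T : Submodule F V} (h : IsBisection k S T)
    {f : V →ₗ[F] F} {π : LinearMap.ker f →ₗ[F] W} {v a b : V}
    (hπ : ∀ x, π x = 0 → (x : V) ∈ Submodule.span F {v}) (hvS : v ∉ S) (hvT : v ∉ T)
    (ha : a ∈ S) (hb : b ∈ T) (hab : a + b = v) (hfa : f a ≠ 0) (hfb : f b ≠ 0) :
    IsBisection (k - 1) ((S.comap (LinearMap.ker f).subtype).map π)
      ((T.comap (LinearMap.ker f).subtype).map π) := by
  obtain ⟨hS, hT, hinf, -⟩ := h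
  have hdim {R : Submodule F V} {x : V} (hR : finrank F R = k) (hvR : v ∉ R) (hx : x ∈ R)
      (hfx : f x ≠ 0) : finrank F ((R.comap (LinearMap.ker f).subtype).map π) = k - 1 := by
    have h₁ := finrank_map_add_finrank_inf_ker π (R.comap (LinearMap.ker f).subtype)
    have h₂ : R.comap (LinearMap.ker f).subtype ⊓ LinearMap.ker π = ⊥ := by
      rw [eq_bot_iff]
      rintro y ⟨hyR, hy⟩
      obtain ⟨c, hc⟩ := Submodule.mem_span_singleton.1 (hπ y hy)
      have hc0 : c = 0 := by
        by_contra hc0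
        have : c • v ∈ R := hc ▸ hyR
        exact hvR ((R.smul_mem_iff hc0).1 this)
      rw [hc0, zero_smul] at hc
      exact Subtype.ext hc.symm
    have h₃ := finrank_inf_ker_add_one hx hfx
    rw [inf_comm, ← Submodule.map_comap_subtype, Submodule.finrank_map_subtype_eq, hR] at h₃
    rw [h₂, finrank_bot] at h₁
    omega
  have hdS := hdim hS hvS ha hfa
  have hdT := hdim hT hvT hb hfb
  have hbot : (S.comap (LinearMap.ker f).subtype).map π ⊓
      (T.comap (LinearMap.ker f).subtype).map π = ⊥ := by
    rw [eq_bot_iff]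
    rintro _ ⟨⟨s, hs, rfl⟩, t, ht, hst⟩
    obtain ⟨c, hc⟩ := Submodule.mem_span_singleton.1 (hπ (s - t) (by rw [map_sub, hst, sub_self]))
    have hc' : (s : V) - c • a = t + c • b := by
      rw [← hab, smul_add, Submodule.coe_sub] at hc
      rw [← eq_sub_iff_add_eq.1 hc]
      abel
    have hmem : (s : V) - c • a ∈ S ⊓ T :=
      ⟨S.sub_mem hs (S.smul_mem c ha), hc' ▸ T.add_mem ht (T.smul_mem c hb)⟩
    rw [hinf, Submodule.mem_bot, sub_eq_zero] at hmem
    have hfs : f s = 0 := s.2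
    rw [hmem, map_smul, smul_eq_mul] at hfs
    have hc0 := (mul_eq_zero.1 hfs).resolve_right hfa
    rw [hc0, zero_smul] at hmem
    have hs0 : s = 0 := Subtype.ext hmem
    simp [hs0]
  refine ⟨hdS, hdT, hbot, Submodule.eq_top_of_disjoint _ _ ?_ (disjoint_iff.2 hbot)⟩
  omega

theorem finrank_map_subtype_comap [FiniteDimensional F V] {H : Submodule F V} {π : H →ₗ[F] W}
    (hπ : Function.Surjective π) (U : Submodule F W) :
    finrank F ((U.comap π).map H.subtype) = finrank F U + finrank F (LinearMap.ker π) := by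
  rw [Submodule.finrank_map_subtype_eq, ← finrank_map_add_finrank_inf_ker π,
    Submodule.map_comap_eq_of_surjective hπ, inf_eq_right.2 (LinearMap.ker_le_comap π)]

theorem map_subtype_comap_inf_eq_bot {H S : Submodule F V} {π : H →ₗ[F] W} {U : Submodule F W}
    {v : V} (hπ : ∀ x, π x = 0 → (x : V) ∈ Submodule.span F {v}) (hv : v ∉ S)
    (hU : U ⊓ (S.comap H.subtype).map π = ⊥) : (U.comap π).map H.subtype ⊓ S = ⊥ := by
  rw [eq_bot_iff]
  rintro _ ⟨⟨x, hx, rfl⟩, hxS⟩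
  have hmem : π x ∈ U ⊓ (S.comap H.subtype).map π := ⟨hx, x, hxS, rfl⟩
  rw [hU, Submodule.mem_bot] at hmem
  obtain ⟨c, hc⟩ := Submodule.mem_span_singleton.1 (hπ x hmem)
  have hc0 : c = 0 := by
    by_contra hc0
    have : c • v ∈ S := hc ▸ hxS
    exact hv ((S.smul_mem_iff hc0).1 this)
  rw [hc0, zero_smul] at hc
  exact hc.symm

/-- A space maps onto any space of dimension one less, with kernel a prescribed line. -/
theorem exists_surjective_ker_eq_span_singleton [FiniteDimensional F V] [FiniteDimensional F W]
    (x : V) (hx : x ≠ 0) (hVW : finrank F V = finrank F W + 1) :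
    ∃ π : V →ₗ[F] W, Function.Surjective π ∧ LinearMap.ker π = Submodule.span F {x} := by
  have h := Submodule.finrank_quotient_add_finrank (Submodule.span F {x})
  rw [finrank_span_singleton hx] at h
  let e : (V ⧸ Submodule.span F {x}) ≃ₗ[F] W := LinearEquiv.ofFinrankEq _ _ (by omega)
  refine ⟨e.toLinearMap ∘ₗ (Submodule.span F {x}).mkQ,
    e.surjective.comp (Submodule.mkQ_surjective _), ?_⟩
  rw [LinearEquiv.ker_comp, Submodule.ker_mkQ]

end

theorem concurrentlyComplete_zero_induction
    (F V' V : Type*) [Field F] [Fintype F]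
    [AddCommGroup V'] [Module F V'] [FiniteDimensional F V']
    [AddCommGroup V] [Module F V] [FiniteDimensional F V]
    (k : ℕ) (hk : 2 ≤ k)
    (hV' : finrank F V' = 2 * (k - 1)) (hV : finrank F V = 2 * k)
    (ih : ConcurrentlyCompleteZero F V' (k - 1) (k - 1)) :
    ConcurrentlyCompleteZero F V k k := by
  intro S T S' T' h h' _
  obtain ⟨v, hv⟩ := exists_notMem_four_of_finrank_eq hk hV (p := ![S, T, S', T'])
    (by intro i; fin_cases i; exacts [h.1, h.2.1, h'.1, h'.2.1])
  have hvS : v ∉ S := hv 0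
  have hvT : v ∉ T := hv 1
  have hvS' : v ∉ S' := hv 2
  have hvT' : v ∉ T' := hv 3
  obtain ⟨a, ha, b, hb, hab, hav⟩ := h.exists_add_eq hvS hvT
  obtain ⟨a', ha', b', hb', hab', hav'⟩ := h'.exists_add_eq hvS' hvT'
  obtain ⟨f, hfa, hfa', hf⟩ := exists_dual_ne_zero_ne_zero_le_ker hav hav'
  have hfv : f v = 0 := hf (Submodule.mem_span_singleton_self v)
  have hfb : f b ≠ 0 := by
    intro hfb
    rw [← hab, map_add, hfb, add_zero] at hfv
    exact hfa hfv
  have hfb' : f b' ≠ 0 := by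
    intro hfb'
    rw [← hab', map_add, hfb', add_zero] at hfv
    exact hfa' hfv
  have hv0 : (⟨v, hfv⟩ : LinearMap.ker f) ≠ 0 := fun h0 ↦
    hvS (by rw [show v = 0 from congrArg Subtype.val h0]; exact S.zero_mem)
  have hH := Module.Dual.finrank_ker_add_one_of_ne_zero (f := f) (fun h0 ↦ hfa (by simp [h0]))
  obtain ⟨π, hπ, hker⟩ := exists_surjective_ker_eq_span_singleton (F := F) (W := V')
    (⟨v, hfv⟩ : LinearMap.ker f) hv0 (by omega)
  have hπv (x : LinearMap.ker f) (hx : π x = 0) : (x : V) ∈ Submodule.span F {v} := by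
    rw [← LinearMap.mem_ker, hker] at hx
    obtain ⟨c, rfl⟩ := Submodule.mem_span_singleton.1 hx
    exact Submodule.mem_span_singleton.2 ⟨c, rfl⟩
  have hW := h.map_comap_subtype_ker hV' hπv hvS hvT ha hb hab hfa hfb
  have hW' := h'.map_comap_subtype_ker hV' hπv hvS' hvT' ha' hb' hab' hfa' hfb'
  obtain ⟨U, hU, h₁, h₂, h₁', h₂'⟩ : ∃ U : Submodule F V', finrank F U = k - 1 ∧
      U ⊓ (S.comap (LinearMap.ker f).subtype).map π = ⊥ ∧
      U ⊓ (T.comap (LinearMap.ker f).subtype).map π = ⊥ ∧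
      U ⊓ (S'.comap (LinearMap.ker f).subtype).map π = ⊥ ∧
      U ⊓ (T'.comap (LinearMap.ker f).subtype).map π = ⊥ := by
    by_cases heq : ({(S.comap (LinearMap.ker f).subtype).map π,
        (T.comap (LinearMap.ker f).subtype).map π} : Set (Submodule F V')) =
        {(S'.comap (LinearMap.ker f).subtype).map π, (T'.comap (LinearMap.ker f).subtype).map π}
    · obtain ⟨U, hU, hUS, hUT⟩ := hW.exists_common_complement
      have hall : ∀ X ∈ ({(S.comap (LinearMap.ker f).subtype).map π,
          (T.comap (LinearMap.ker f).subtype).map π} : Set (Submodule F V')), U ⊓ X = ⊥ := by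
        rintro X (rfl | rfl)
        exacts [hUS, hUT]
      rw [heq] at hall
      exact ⟨U, hU, hUS, hUT, hall _ (Or.inl rfl), hall _ (Or.inr rfl)⟩
    · exact ih _ _ _ _ hW hW' heq
  refine ⟨(U.comap π).map (LinearMap.ker f).subtype, ?_, map_subtype_comap_inf_eq_bot hπv hvS h₁,
    map_subtype_comap_inf_eq_bot hπv hvT h₂, map_subtype_comap_inf_eq_bot hπv hvS' h₁',
    map_subtype_comap_inf_eq_bot hπv hvT' h₂'⟩
  rw [finrank_map_subtype_comap hπ, hker, finrank_span_singleton hv0, hU]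
  omega
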